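/- Let π and π' be two distinct degree sequences of trees with π ◁ π' (π is majorized by π'). Let G and G' be trees with greatest spectral radius among all trees with degree sequence π and π', respectively. Then λ(G) < λ(G'). -/

import Mathlib

open Finset

variable {V : Type*} {W : Type*}

/-- The adjacency matrix of a finite simple graph, with real entries. -/
noncomputable def adjMat [Fintype V] (G : SimpleGraph V) : Matrix V V ℝ :=
  letI := Classical.decRel G.Adj
  G.adjMatrix ℝ

/-- The spectral radius `λ(G)`: the largest eigenvalue of the adjacency matrix. -/
noncomputable def specRad [Fintype V] (G : SimpleGraph V) : ℝ :=
  sSup {μ : ℝ | ∃ f : V → ℝ, f ≠ 0 ∧ (adjMat G).mulVec f = μ • f}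

/-- The degree of a vertex. -/
noncomputable def deg [Fintype V] (G : SimpleGraph V) (v : V) : ℕ :=
  letI := Classical.decRel G.Adj
  G.degree v

/-- The degree sequence of `G`, as a multiset. -/
noncomputable def degMultiset [Fintype V] (G : SimpleGraph V) : Multiset ℕ :=
  Finset.univ.val.map (deg G)

/-- `G` has the degree sequence `d` (a sequence of length `n`). -/
def hasDegSeq [Fintype V] (G : SimpleGraph V) {n : ℕ} (d : Fin n → ℕ) : Prop :=
  Finset.univ.val.map d = degMultiset G

/-- `f` is the Perron vector of `G`: a positive unit eigenvector for the
largest eigenvalue. -/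
def IsPerronVector [Fintype V] (G : SimpleGraph V) (f : V → ℝ) : Prop :=
  (∀ v, 0 < f v) ∧ (∑ v, f v ^ 2 = 1) ∧ (adjMat G).mulVec f = specRad G • f

/-- `N_f(v) = Σ_{u ∼ v} f(u)`. -/
noncomputable def Nf [Fintype V] (G : SimpleGraph V) (f : V → ℝ) (v : V) : ℝ :=
  letI := Classical.decRel G.Adj
  ∑ u ∈ G.neighborFinset v, f u

/-- `w` is the parent of `v` w.r.t. the ordering `ord` (with root `ord.symm 0`):
`w` is the `ord`-least neighbor of `v` whose height is one less than that of `v`. -/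
def IsParent [Fintype V] [Nonempty V] (G : SimpleGraph V)
    (ord : V ≃ Fin (Fintype.card V)) (w v : V) : Prop :=
  G.Adj w v ∧ G.dist (ord.symm ⟨0, Fintype.card_pos⟩) w + 1
      = G.dist (ord.symm ⟨0, Fintype.card_pos⟩) v ∧
    ∀ w' : V, G.Adj w' v →
      G.dist (ord.symm ⟨0, Fintype.card_pos⟩) w' + 1
        = G.dist (ord.symm ⟨0, Fintype.card_pos⟩) v → ord w ≤ ord w'

/-- `ord` is a breadth-first search ordering with decreasing degrees (BFD-ordering):
vertices are listed layer by layer by distance from the root (the `ord`-least vertex),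
(B1) children of earlier parents come before children of later parents, and
(B2) earlier vertices have larger or equal degrees. -/
def IsBFDOrdering [Fintype V] [Nonempty V] (G : SimpleGraph V)
    (ord : V ≃ Fin (Fintype.card V)) : Prop :=
  (∀ u v : V, ord u ≤ ord v →
      G.dist (ord.symm ⟨0, Fintype.card_pos⟩) u
        ≤ G.dist (ord.symm ⟨0, Fintype.card_pos⟩) v) ∧
  (∀ w1 w2 v1 v2 : V, ord w1 < ord w2 →
      IsParent G ord w1 v1 → IsParent G ord w2 v2 → ord v1 < ord v2) ∧
  (∀ u v : V, ord u < ord v → deg G v ≤ deg G u)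

/-- A tree degree sequence: non-increasing, positive entries, summing to `2(n-1)`. -/
def IsTreeDegSeq {n : ℕ} (d : Fin n → ℕ) : Prop :=
  Antitone d ∧ (∀ i, 0 < d i) ∧ ∑ i, d i = 2 * (n - 1)

/-- `Σ_{uv ∈ E(G)} f(u) f(v)`. -/
noncomputable def edgeSum [Fintype V] [DecidableEq V] (G : SimpleGraph V) (f : V → ℝ) : ℝ :=
  letI := Classical.decRel G.Adj
  ∑ e ∈ G.edgeFinset, Sym2.lift ⟨fun u v => f u * f v, fun u v => mul_comm (f u) (f v)⟩ e

/-- The graph obtained from `G` by switching: replacing edges `v1u1`, `v2u2`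
by `v1v2`, `u1u2`. -/
noncomputable def switched (G : SimpleGraph V) (v1 u1 v2 u2 : V) : SimpleGraph V :=
  SimpleGraph.fromEdgeSet ((G.edgeSet \ {s(v1, u1), s(v2, u2)}) ∪ {s(v1, v2), s(u1, u2)})

/-- The graph obtained from `G` by shifting: replacing the edge `uv1` by `uv2`. -/
noncomputable def shifted (G : SimpleGraph V) (u v1 v2 : V) : SimpleGraph V :=
  SimpleGraph.fromEdgeSet ((G.edgeSet \ {s(u, v1)}) ∪ {s(u, v2)})

open Matrix in
/-- A real matrix on a nonempty index type has a unit vector maximizing the quadratic form. -/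
theorem exists_quadForm_max [Fintype V] [Nonempty V] (A : Matrix V V ℝ) :
    ∃ f : V → ℝ, f ⬝ᵥ f = 1 ∧ ∀ x : V → ℝ, x ⬝ᵥ A *ᵥ x ≤ (f ⬝ᵥ A *ᵥ f) * (x ⬝ᵥ x) := by
  classical
  have hbound : ∀ x ∈ {x : V → ℝ | x ⬝ᵥ x = 1}, ∀ i, ‖x i‖ ≤ 1 := by
    intro x hx i
    have h : x i * x i ≤ ∑ j, x j * x j :=
      Finset.single_le_sum (f := fun j => x j * x j)
        (fun j _ => mul_self_nonneg _) (Finset.mem_univ i)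
    have hx' : ∑ j, x j * x j = 1 := hx
    rw [Real.norm_eq_abs, ← abs_one]
    exact sq_le_sq.mp (by nlinarith)
  have hcompact : IsCompact {x : V → ℝ | x ⬝ᵥ x = 1} := by
    refine Metric.isCompact_of_isClosed_isBounded ?_ ?_
    · exact isClosed_eq (by simp only [dotProduct]; fun_prop) continuous_const
    · refine isBounded_iff_forall_norm_le.mpr ⟨1, fun x hx => ?_⟩
      exact (pi_norm_le_iff_of_nonneg zero_le_one).mpr (hbound x hx)
  obtain ⟨v⟩ := ‹Nonempty V›
  have hne : {x : V → ℝ | x ⬝ᵥ x = 1}.Nonempty := ⟨Pi.single v 1, by simp⟩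
  obtain ⟨f, hf, hmax⟩ := hcompact.exists_isMaxOn hne
    (f := fun x => x ⬝ᵥ A *ᵥ x)
    (by simp only [dotProduct, mulVec]; fun_prop)
  refine ⟨f, hf, fun x => ?_⟩
  by_cases hx : x = 0
  · simp [hx]
  have hpos : 0 < x ⬝ᵥ x :=
    lt_of_le_of_ne (Finset.sum_nonneg fun i _ => mul_self_nonneg _)
      (fun h => hx (dotProduct_self_eq_zero.mp h.symm))
  have hc := Real.mul_self_sqrt hpos.le
  have hcpos := Real.sqrt_pos.mpr hpos
  set c := Real.sqrt (x ⬝ᵥ x)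
  have hy : (c⁻¹ • x) ⬝ᵥ (c⁻¹ • x) = 1 := by
    rw [smul_dotProduct, dotProduct_smul, ← hc]
    simp only [smul_eq_mul]
    field_simp
  have hm : (c⁻¹ • x) ⬝ᵥ A *ᵥ (c⁻¹ • x) ≤ f ⬝ᵥ A *ᵥ f := hmax hy
  rw [mulVec_smul, smul_dotProduct, dotProduct_smul, smul_eq_mul, smul_eq_mul] at hm
  rw [← hc]
  have : x ⬝ᵥ A *ᵥ x = (c⁻¹ * (c⁻¹ * (x ⬝ᵥ A *ᵥ x))) * (c * c) := by field_simp
  rw [this]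
  exact mul_le_mul_of_nonneg_right hm (mul_self_nonneg c)

open Matrix in
/-- For a symmetric matrix, a vector attaining the bound `M` of the Rayleigh quotient
is an eigenvector. -/
theorem mulVec_eq_smul_of_quadForm_max [Fintype V] {A : Matrix V V ℝ} (hA : A.IsSymm) {M : ℝ}
    (hM : ∀ x : V → ℝ, x ⬝ᵥ A *ᵥ x ≤ M * (x ⬝ᵥ x)) {f : V → ℝ}
    (hf : f ⬝ᵥ A *ᵥ f = M * (f ⬝ᵥ f)) : A *ᵥ f = M • f := by
  classical
  have key : ∀ x : V → ℝ, x ⬝ᵥ (M • (1 : Matrix V V ℝ) - A) *ᵥ x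
      = M * (x ⬝ᵥ x) - x ⬝ᵥ A *ᵥ x := by
    intro x
    rw [sub_mulVec, dotProduct_sub, smul_mulVec, one_mulVec, dotProduct_smul, smul_eq_mul]
  have hpsd : (M • (1 : Matrix V V ℝ) - A).PosSemidef := by
    refine PosSemidef.of_dotProduct_mulVec_nonneg ?_ fun x => ?_
    · ext i j
      simp [conjTranspose_apply, one_apply, eq_comm, hA.apply]
    · rw [star_trivial, key]
      linarith [hM x]
  have h0 := (hpsd.dotProduct_mulVec_zero_iff f).mp (by rw [star_trivial, key]; linarith)
  rw [sub_mulVec, smul_mulVec, one_mulVec, sub_eq_zero] at h0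
  exact h0.symm

theorem adjMat_apply [Fintype V] (G : SimpleGraph V) (u v : V) [Decidable (G.Adj u v)] :
    adjMat G u v = if G.Adj u v then 1 else 0 := by
  classical
  simp only [adjMat, SimpleGraph.adjMatrix_apply]
  congr

theorem adjMat_isSymm [Fintype V] (G : SimpleGraph V) : (adjMat G).IsSymm := by
  classical
  exact SimpleGraph.isSymm_adjMatrix _

open Matrix in
/-- The spectral radius is the maximum of the Rayleigh quotient. -/
theorem specRad_eq_of_quadForm_max [Fintype V] (G : SimpleGraph V) {f : V → ℝ}
    (hf : f ⬝ᵥ f = 1)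
    (hmax : ∀ x : V → ℝ, x ⬝ᵥ adjMat G *ᵥ x ≤ (f ⬝ᵥ adjMat G *ᵥ f) * (x ⬝ᵥ x)) :
    specRad G = f ⬝ᵥ adjMat G *ᵥ f := by
  have hmem : adjMat G *ᵥ f = (f ⬝ᵥ adjMat G *ᵥ f) • f :=
    mulVec_eq_smul_of_quadForm_max (adjMat_isSymm G) hmax (by rw [hf, mul_one])
  have hf0 : f ≠ 0 := by rintro rfl; simp at hf
  refine IsGreatest.csSup_eq ⟨⟨f, hf0, hmem⟩, ?_⟩
  rintro μ ⟨g, hg0, hg⟩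
  have h := hmax g
  rw [hg, dotProduct_smul, smul_eq_mul] at h
  have hpos : 0 < g ⬝ᵥ g :=
    lt_of_le_of_ne (Finset.sum_nonneg fun i _ => mul_self_nonneg _)
      (fun h => hg0 (dotProduct_self_eq_zero.mp h.symm))
  exact le_of_mul_le_mul_right h hpos

open Matrix in
theorem quadForm_le_specRad [Fintype V] [Nonempty V] (G : SimpleGraph V) (x : V → ℝ) :
    x ⬝ᵥ adjMat G *ᵥ x ≤ specRad G * (x ⬝ᵥ x) := by
  obtain ⟨f, hf, hmax⟩ := exists_quadForm_max (adjMat G)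
  rw [specRad_eq_of_quadForm_max G hf hmax]
  exact hmax x

open Matrix in
/-- A connected graph has a positive eigenvector for its spectral radius. -/
theorem exists_pos_eigenvector [Fintype V] {G : SimpleGraph V} (hG : G.Connected) :
    ∃ f : V → ℝ, (∀ v, 0 < f v) ∧ adjMat G *ᵥ f = specRad G • f := by
  classical
  have := hG.nonempty
  obtain ⟨f, hf, hmax⟩ := exists_quadForm_max (adjMat G)
  have hspec := specRad_eq_of_quadForm_max G hf hmax
  set g : V → ℝ := fun v => |f v|
  have hgg : g ⬝ᵥ g = 1 := by
    rw [← hf]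
    exact Finset.sum_congr rfl fun i _ => abs_mul_abs_self _
  have hle : f ⬝ᵥ adjMat G *ᵥ f ≤ g ⬝ᵥ adjMat G *ᵥ g := by
    simp only [dotProduct, mulVec, Finset.mul_sum]
    refine Finset.sum_le_sum fun i _ => Finset.sum_le_sum fun j _ => ?_
    refine (le_abs_self _).trans ?_
    rw [abs_mul, abs_mul, adjMat_apply]
    split_ifs <;> simp [g]
  have hg : adjMat G *ᵥ g = specRad G • g := by
    refine mulVec_eq_smul_of_quadForm_max (adjMat_isSymm G) (quadForm_le_specRad G) ?_
    refine le_antisymm (quadForm_le_specRad G g) ?_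
    rw [hspec, hgg, mul_one]
    exact hle
  have hg0 : ∀ v, 0 ≤ g v := fun v => abs_nonneg _
  have hstep : ∀ u v, G.Adj u v → g u = 0 → g v = 0 := by
    intro u v huv hu
    have h := congrFun hg u
    rw [Pi.smul_apply, hu, smul_zero] at h
    have hnn : ∀ j ∈ Finset.univ, 0 ≤ adjMat G u j * g j := fun j _ =>
      mul_nonneg (by rw [adjMat_apply]; split_ifs <;> simp) (hg0 j)
    have h' := (Finset.sum_eq_zero_iff_of_nonneg hnn).mp h v (Finset.mem_univ v)
    rwa [adjMat_apply, if_pos huv, one_mul] at h'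
  refine ⟨g, fun v => lt_of_le_of_ne (hg0 v) fun hv => ?_, hg⟩
  have hall : ∀ w, g w = 0 := by
    intro w
    obtain ⟨p⟩ := hG.preconnected v w
    induction p with
    | nil => exact hv.symm
    | cons h _ ih => exact ih (hstep _ _ h hv.symm).symm
  have : g = 0 := funext hall
  rw [this] at hgg
  simp at hgg

open Matrix in
/-- Comparison of spectral radii through a positive eigenvector of the first graph. -/
theorem specRad_lt_of_quadForm_le [Fintype V] {G H : SimpleGraph V}
    {f : V → ℝ} {b : V} (hf : 0 < f b) (hGf : adjMat G *ᵥ f = specRad G • f)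
    (hle : f ⬝ᵥ adjMat G *ᵥ f ≤ f ⬝ᵥ adjMat H *ᵥ f)
    (hlt : (adjMat G *ᵥ f) b < (adjMat H *ᵥ f) b) : specRad G < specRad H := by
  have : Nonempty V := ⟨b⟩
  have hpos : 0 < f ⬝ᵥ f :=
    lt_of_le_of_ne (Finset.sum_nonneg fun i _ => mul_self_nonneg _)
      (fun h => hf.ne' (congrFun (dotProduct_self_eq_zero.mp h.symm) b))
  have hH := quadForm_le_specRad H f
  rw [hGf, dotProduct_smul, smul_eq_mul] at hle
  refine lt_of_le_of_ne (le_of_mul_le_mul_right (hle.trans hH) hpos) fun heq => ?_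
  have hHf : adjMat H *ᵥ f = specRad H • f :=
    mulVec_eq_smul_of_quadForm_max (adjMat_isSymm H) (quadForm_le_specRad H)
      (le_antisymm hH (heq ▸ hle))
  rw [hGf, hHf, heq] at hlt
  exact lt_irrefl _ hlt

open Matrix in
theorem adjMat_mulVec_one [Fintype V] (G : SimpleGraph V) (v : V) :
    (adjMat G *ᵥ fun _ => 1) v = deg G v := by
  classical
  simp [adjMat, deg]

open Matrix in
/-- The effect on the adjacency operator of replacing the edge `wa` by `wb`. -/
theorem adjMat_replace_edge_mulVec [Fintype V] [DecidableEq V] {G : SimpleGraph V} {a b w : V}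
    (haw : G.Adj a w) (hbw : ¬ G.Adj b w) (hne : b ≠ w) (g : V → ℝ) (x : V) :
    (adjMat (G.deleteEdges {s(a, w)} ⊔ SimpleGraph.edge b w) *ᵥ g) x =
      (adjMat G *ᵥ g) x - (if x = a then g w else 0) - (if x = w then g a else 0)
        + (if x = b then g w else 0) + (if x = w then g b else 0) := by
  classical
  have hA : adjMat (G.deleteEdges {s(a, w)} ⊔ SimpleGraph.edge b w)
      = adjMat G - single a w 1 - single w a 1 + single b w 1 + single w b 1 := by
    have haw' := haw.ne
    have hab : a ≠ b := by rintro rfl; exact hbw haw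
    ext x y
    simp only [adjMat_apply, Matrix.add_apply, Matrix.sub_apply, Matrix.single_apply,
      SimpleGraph.sup_adj, SimpleGraph.deleteEdges_adj, SimpleGraph.edge_adj,
      Set.mem_singleton_iff, Sym2.eq_iff]
    by_cases h1 : x = a ∧ y = w
    · obtain ⟨rfl, rfl⟩ := h1
      simp [haw, haw', haw'.symm, hab, hab.symm, hne.symm]
    by_cases h2 : x = w ∧ y = a
    · obtain ⟨rfl, rfl⟩ := h2
      simp [haw.symm, haw', haw'.symm, hab, hab.symm, hne.symm]
    by_cases h3 : x = b ∧ y = w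
    · obtain ⟨rfl, rfl⟩ := h3
      simp [hbw, hne, hab, hab.symm, hne.symm]
    by_cases h4 : x = w ∧ y = b
    · obtain ⟨rfl, rfl⟩ := h4
      have : ¬ G.Adj x y := fun h => hbw h.symm
      simp [this, hne, hab, hab.symm, hne.symm]
    have h1' : ¬ (a = x ∧ w = y) := fun h => h1 ⟨h.1.symm, h.2.symm⟩
    have h2' : ¬ (w = x ∧ a = y) := fun h => h2 ⟨h.1.symm, h.2.symm⟩
    have h3' : ¬ (b = x ∧ w = y) := fun h => h3 ⟨h.1.symm, h.2.symm⟩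
    have h4' : ¬ (w = x ∧ b = y) := fun h => h4 ⟨h.1.symm, h.2.symm⟩
    simp [h1, h2, h3, h4, h1', h2', h3', h4']
  rw [hA]
  simp only [Matrix.add_mulVec, Matrix.sub_mulVec, Matrix.single_mulVec_eq, Pi.add_apply,
    Pi.sub_apply, Pi.smul_apply, Pi.single_apply, one_mul, smul_eq_mul, mul_ite, mul_one, mul_zero]

open SimpleGraph in
/-- Replacing the edge `aw` of a tree by `bw` gives a tree when `w` lies away from the
path from `a` to `b`. -/
theorem isTree_replace_edge {G : SimpleGraph V} (hG : G.IsTree) {a b w : V}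
    (haw : G.Adj a w) (hab : (G.deleteEdges {s(a, w)}).Reachable a b) :
    (G.deleteEdges {s(a, w)} ⊔ edge b w).IsTree := by
  have hbridge : ¬ (G.deleteEdges {s(a, w)}).Reachable a w :=
    isBridge_iff.mp (isAcyclic_iff_forall_adj_isBridge.mp hG.isAcyclic haw)
  have hbw : b ≠ w := by rintro rfl; exact hbridge hab
  refine ⟨?_, ?_⟩
  · have hnew : (G.deleteEdges {s(a, w)} ⊔ edge b w).Reachable a w :=
      (hab.mono le_sup_left).trans
        (Adj.reachable (by simp [sup_adj, edge_adj, hbw]))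
    have := hG.connected.nonempty
    refine ⟨fun x y => ?_⟩
    obtain ⟨p⟩ := hG.connected.preconnected x y
    induction p with
    | nil => exact Reachable.refl _
    | @cons u v _ h _ ih =>
      refine Reachable.trans ?_ ih
      by_cases he : s(u, v) = s(a, w)
      · rcases Sym2.eq_iff.mp he with ⟨rfl, rfl⟩ | ⟨rfl, rfl⟩
        · exact hnew
        · exact hnew.symm
      · exact Adj.reachable (Or.inl (by simpa [deleteEdges_adj, h] using he))
  · refine (hG.isAcyclic.anti (deleteEdges_le _)).sup_edge_of_not_reachable fun h => ?_
    exact hbridge (hab.trans h)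

open SimpleGraph in
/-- A vertex `a` of degree at least two in a tree has a neighbour away from the path to `b`. -/
theorem exists_adj_reachable_deleteEdges [Fintype V] {G : SimpleGraph V} (hG : G.IsTree)
    {a b : V} (ha : 2 ≤ deg G a) :
    ∃ w, G.Adj a w ∧ (G.deleteEdges {s(a, w)}).Reachable a b := by
  classical
  obtain ⟨p, hp, -⟩ := hG.existsUnique_path a b
  have hcard : 1 < (G.neighborFinset a).card := by
    have h2 : 2 ≤ G.degree a := by
      convert ha
      simp only [deg]
    rwa [card_neighborFinset_eq_degree]
  obtain ⟨w, hw, hwne⟩ := Finset.exists_mem_ne hcard p.snd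
  rw [mem_neighborFinset] at hw
  refine ⟨w, hw, ?_⟩
  refine ⟨p.toDeleteEdges _ fun e he hmem => ?_⟩
  rw [Set.mem_singleton_iff] at hmem
  subst hmem
  cases p with
  | nil => simp at he
  | cons h q =>
    rw [Walk.edges_cons, List.mem_cons] at he
    rcases he with he | he
    · rcases Sym2.eq_iff.mp he with ⟨-, h2⟩ | ⟨h1, h2⟩
      · exact hwne (by simpa using h2)
      · exact h.ne h1
    · exact ((Walk.cons_isPath_iff h q).mp hp).2 (q.fst_mem_support_of_mem_edges he)

open Matrix in
/-- Moving one branch of a tree from `a` to a vertex `b` where the positive weight `f`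
is at least as large. -/
theorem exists_tree_move_branch [Fintype V] {G : SimpleGraph V} (hG : G.IsTree)
    {f : V → ℝ} (hf : ∀ v, 0 < f v) {a b : V} (hab : a ≠ b) (hfab : f a ≤ f b)
    (ha : 2 ≤ deg G a) :
    ∃ H : SimpleGraph V, H.IsTree ∧ deg H a + 1 = deg G a ∧ deg H b = deg G b + 1 ∧
      (∀ x, x ≠ a → x ≠ b → deg H x = deg G x) ∧
      f ⬝ᵥ adjMat G *ᵥ f ≤ f ⬝ᵥ adjMat H *ᵥ f ∧
      (adjMat G *ᵥ f) b < (adjMat H *ᵥ f) b := by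
  classical
  obtain ⟨w, haw, hreach⟩ := exists_adj_reachable_deleteEdges hG (b := b) ha
  have hbridge : ¬ (G.deleteEdges {s(a, w)}).Reachable a w :=
    SimpleGraph.isBridge_iff.mp
      (SimpleGraph.isAcyclic_iff_forall_adj_isBridge.mp hG.isAcyclic haw)
  have hbw : b ≠ w := by rintro rfl; exact hbridge hreach
  have hnadj : ¬ G.Adj b w := fun h => hbridge <| hreach.trans <| SimpleGraph.Adj.reachable <| by
    simp [SimpleGraph.deleteEdges_adj, h, hab.symm, hbw]
  have haw' := haw.ne
  have hform := adjMat_replace_edge_mulVec haw hnadj hbw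
  have hdeg : ∀ x, (deg (G.deleteEdges {s(a, w)} ⊔ SimpleGraph.edge b w) x : ℝ)
      = deg G x - (if x = a then 1 else 0) + (if x = b then 1 else 0) := by
    intro x
    rw [← adjMat_mulVec_one, ← adjMat_mulVec_one, hform]
    ring
  refine ⟨_, isTree_replace_edge hG haw hreach, ?_, ?_, fun x hxa hxb => ?_, ?_, ?_⟩
  · have h := hdeg a
    rw [if_pos rfl, if_neg hab] at h
    rify
    linarith
  · have h := hdeg b
    rw [if_pos rfl, if_neg hab.symm] at h
    rify
    linarith
  · have h := hdeg x
    rw [if_neg hxa, if_neg hxb] at h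
    rify
    linarith
  · have hq : f ⬝ᵥ adjMat (G.deleteEdges {s(a, w)} ⊔ SimpleGraph.edge b w) *ᵥ f
        = f ⬝ᵥ adjMat G *ᵥ f + 2 * (f w * (f b - f a)) := by
      simp only [dotProduct, hform, mul_add, mul_sub, Finset.sum_add_distrib,
        Finset.sum_sub_distrib, mul_ite, mul_zero, Finset.sum_ite_eq', Finset.mem_univ, if_true]
      ring
    rw [hq]
    have := mul_nonneg (hf w).le (sub_nonneg.mpr hfab)
    linarith
  · rw [hform, if_neg hab.symm, if_neg hbw, if_pos rfl, if_neg hbw]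
    linarith [hf w]

open Matrix in
/-- Moving `k + 1` branches of a tree from `a` to a vertex `b` where the positive weight `f`
is at least as large. -/
theorem exists_tree_move_branches [Fintype V] {G : SimpleGraph V} (hG : G.IsTree)
    {f : V → ℝ} (hf : ∀ v, 0 < f v) {a b : V} (hab : a ≠ b) (hfab : f a ≤ f b)
    (k : ℕ) (ha : k + 2 ≤ deg G a) :
    ∃ H : SimpleGraph V, H.IsTree ∧ deg H a + (k + 1) = deg G a ∧
      deg H b = deg G b + (k + 1) ∧
      (∀ x, x ≠ a → x ≠ b → deg H x = deg G x) ∧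
      f ⬝ᵥ adjMat G *ᵥ f ≤ f ⬝ᵥ adjMat H *ᵥ f ∧
      (adjMat G *ᵥ f) b < (adjMat H *ᵥ f) b := by
  induction k with
  | zero => exact exists_tree_move_branch hG hf hab hfab ha
  | succ k ih =>
    obtain ⟨H, hH, h1, h2, h3, h4, h5⟩ := ih (by omega)
    obtain ⟨K, hK, k1, k2, k3, k4, k5⟩ :=
      exists_tree_move_branch hH hf hab hfab (by omega)
    exact ⟨K, hK, by omega, by omega, fun x hxa hxb => (k3 x hxa hxb).trans (h3 x hxa hxb),
      h4.trans k4, h5.trans k5⟩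

/-- A unit transfer of degree from `v` to a vertex `u` of at least the same degree can be
realized, up to exchanging `u` and `v`, by a tree of larger spectral radius. -/
theorem exists_tree_transfer_degree [Fintype V] {G : SimpleGraph V} (hG : G.IsTree)
    {u v : V} (huv : u ≠ v) (hle : deg G v ≤ deg G u) (hv : 2 ≤ deg G v) :
    ∃ H : SimpleGraph V, H.IsTree ∧ specRad G < specRad H ∧
      (∀ x, x ≠ u → x ≠ v → deg H x = deg G x) ∧
      ((deg H u = deg G u + 1 ∧ deg H v = deg G v - 1) ∨
        (deg H v = deg G u + 1 ∧ deg H u = deg G v - 1)) := by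
  obtain ⟨f, hf, hfe⟩ := exists_pos_eigenvector hG.connected
  rcases le_total (f v) (f u) with h | h
  · obtain ⟨H, hH, h1, h2, h3, h4, h5⟩ := exists_tree_move_branch hG hf huv.symm h hv
    exact ⟨H, hH, specRad_lt_of_quadForm_le (hf u) hfe h4 h5,
      fun x hxu hxv => h3 x hxv hxu, Or.inl ⟨h2, by omega⟩⟩
  · obtain ⟨H, hH, h1, h2, h3, h4, h5⟩ :=
      exists_tree_move_branches hG hf huv h (deg G u - deg G v) (by omega)
    exact ⟨H, hH, specRad_lt_of_quadForm_le (hf v) hfe h4 h5, h3,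
      Or.inr ⟨by omega, by omega⟩⟩

theorem sum_Iic_succ {n : ℕ} (d : Fin n → ℕ) {k : ℕ} (hk : k + 1 < n) :
    ∑ i ∈ Finset.Iic (⟨k + 1, hk⟩ : Fin n), d i
      = ∑ i ∈ Finset.Iic (⟨k, by omega⟩ : Fin n), d i + d ⟨k + 1, hk⟩ := by
  have h : Finset.Iic (⟨k + 1, hk⟩ : Fin n)
      = insert ⟨k + 1, hk⟩ (Finset.Iic (⟨k, by omega⟩ : Fin n)) := by
    ext x
    simp only [Finset.mem_Iic, Finset.mem_insert, Fin.le_def, Fin.ext_iff]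
    omega
  rw [h, Finset.sum_insert (by simp [Fin.le_def]), add_comm]

/-- Move one unit of `d` from position `j` to position `i`. -/
def transferUnit {n : ℕ} (d : Fin n → ℕ) (i j : Fin n) (k : Fin n) : ℕ :=
  if k = i then d i + 1 else if k = j then d j - 1 else d k

theorem sum_Iic_transferUnit {n : ℕ} (d : Fin n → ℕ) {i j : Fin n} (hij : i < j)
    (hj : 1 ≤ d j) (k : Fin n) :
    ∑ l ∈ Finset.Iic k, transferUnit d i j l + (if j ≤ k then 1 else 0)
      = ∑ l ∈ Finset.Iic k, d l + (if i ≤ k then 1 else 0) := by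
  have h : ∀ l, transferUnit d i j l + (if l = j then 1 else 0)
      = d l + (if l = i then 1 else 0) := by
    intro l
    have := hij.ne
    unfold transferUnit
    split_ifs <;> subst_vars <;> omega
  have hs := Finset.sum_congr (rfl : Finset.Iic k = Finset.Iic k) fun l _ => h l
  simpa [Finset.sum_add_distrib] using hs

/-- If `d` is strictly majorized by `d'`, some unit transfer brings `d` closer to `d'`
while keeping it non-increasing and majorized by `d'`. -/
theorem exists_transferUnit_majorized {n : ℕ} {d d' : Fin n → ℕ} (hd : Antitone d)
    (hd' : Antitone d') (hpos : ∀ i, 0 < d' i) (hsum : ∑ i, d i = ∑ i, d' i)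
    (hmaj : ∀ j, ∑ i ∈ Finset.Iic j, d i ≤ ∑ i ∈ Finset.Iic j, d' i) (hne : d ≠ d') :
    ∃ i j, i < j ∧ 2 ≤ d j ∧ Antitone (transferUnit d i j) ∧
      ∀ k, ∑ l ∈ Finset.Iic k, transferUnit d i j l ≤ ∑ l ∈ Finset.Iic k, d' l := by
  classical
  obtain ⟨i, hi, himin⟩ : ∃ i, d i ≠ d' i ∧ ∀ l < i, d l = d' l := by
    obtain ⟨i₀, hi₀⟩ := Function.ne_iff.mp hne
    obtain ⟨i, hi, hmin⟩ := WellFounded.has_min (wellFounded_lt (α := Fin n))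
      {i | d i ≠ d' i} ⟨i₀, hi₀⟩
    exact ⟨i, hi, fun l hl => not_not.mp fun h => hmin l h hl⟩
  have hlt : d i < d' i ∧ ∑ l ∈ Finset.Iic i, d l < ∑ l ∈ Finset.Iic i, d' l := by
    have h := hmaj i
    have heq : ∑ l ∈ Finset.Iio i, d l = ∑ l ∈ Finset.Iio i, d' l :=
      Finset.sum_congr rfl fun l hl => himin l (Finset.mem_Iio.mp hl)
    rw [← Finset.Iio_insert, Finset.sum_insert (by simp), Finset.sum_insert (by simp)] at h ⊢
    omega
  obtain ⟨j, ⟨hij, hj⟩, hjmin⟩ : ∃ j, (i ≤ j ∧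
      ∑ l ∈ Finset.Iic j, d l = ∑ l ∈ Finset.Iic j, d' l) ∧
      ∀ k < j, i ≤ k → ∑ l ∈ Finset.Iic k, d l < ∑ l ∈ Finset.Iic k, d' l := by
    have hlast : Finset.Iic (⟨n - 1, by have := i.2; omega⟩ : Fin n) = Finset.univ := by
      ext x
      simp only [Finset.mem_Iic, Fin.le_def, Finset.mem_univ, iff_true]
      omega
    obtain ⟨j, hj, hmin⟩ := WellFounded.has_min (wellFounded_lt (α := Fin n))
      {j | i ≤ j ∧ ∑ l ∈ Finset.Iic j, d l = ∑ l ∈ Finset.Iic j, d' l}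
      ⟨⟨n - 1, by have := i.2; omega⟩, Fin.le_def.mpr (by have := i.2; simp only; omega),
        by rw [hlast]; exact hsum⟩
    exact ⟨j, hj, fun k hk hik => lt_of_le_of_ne (hmaj k) fun h => hmin k ⟨hik, h⟩ hk⟩
  have hij' : i < j := lt_of_le_of_ne hij fun h => by subst h; omega
  have hdj : d' j < d j := by
    obtain ⟨_ | k, hk⟩ := j
    · exact absurd hij' (by simp [Fin.lt_def])
    · have h := hjmin ⟨k, by omega⟩ (by simp [Fin.lt_def])
        (by simp only [Fin.lt_def, Fin.le_def] at hij' ⊢; omega)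
      rw [sum_Iic_succ, sum_Iic_succ] at hj
      omega
  have hbefore : ∀ x < i, d i + 1 ≤ d x := fun x hx => by
    have := hd' hx.le
    have := himin x hx
    omega
  have hafter : ∀ y, j < y → d y + 1 ≤ d j := fun y hy => by
    have hk : j.1 + 1 < n := lt_of_le_of_lt (Nat.succ_le_of_lt hy) y.2
    have h1 : d y ≤ d ⟨j.1 + 1, hk⟩ := hd (Fin.le_def.mpr hy)
    have h2 : d' ⟨j.1 + 1, hk⟩ ≤ d' j := hd' (Fin.le_def.mpr (Nat.le_succ _))
    have h3 := hmaj ⟨j.1 + 1, hk⟩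
    rw [sum_Iic_succ, sum_Iic_succ] at h3
    simp only [Fin.eta] at h3
    omega
  have hposj := hpos j
  refine ⟨i, j, hij', by omega, fun x y hxy => ?_, fun k => ?_⟩
  · have h0 := hd hxy
    have hji : ¬ j ≤ i := not_le.mpr hij'
    have hb : x < i ∨ x = i ∨ i < x := lt_trichotomy x i
    have ha : y < j ∨ y = j ∨ j < y := lt_trichotomy y j
    have hb' := hbefore x
    have ha' := hafter y
    unfold transferUnit
    split_ifs <;> grind
  · have h := sum_Iic_transferUnit d hij' (by omega) k
    have hk := hmaj k
    by_cases h1 : i ≤ k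
    · by_cases h2 : j ≤ k
      · simp only [h1, h2, if_true] at h
        omega
      · have := hjmin k (not_le.mp h2) h1
        simp only [h1, h2, if_true, if_false] at h
        omega
    · have h2 : ¬ j ≤ k := fun h2 => h1 (hij.trans h2)
      simp only [h1, h2, if_false] at h
      omega

/-- Starting from a tree with degrees `d`, any strictly larger tree degree sequence in the
majorization order is realized by a tree of larger spectral radius. -/
theorem exists_tree_specRad_lt {n : ℕ} {d d' : Fin n → ℕ} (hd : Antitone d)
    (hd' : Antitone d') (hpos : ∀ i, 0 < d' i) (hsum : ∑ i, d i = ∑ i, d' i)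
    (hmaj : ∀ j, ∑ i ∈ Finset.Iic j, d i ≤ ∑ i ∈ Finset.Iic j, d' i) (hne : d ≠ d')
    {G : SimpleGraph (Fin n)} (hG : G.IsTree) (σ : Equiv.Perm (Fin n))
    (hσ : ∀ i, deg G (σ i) = d i) :
    ∃ (H : SimpleGraph (Fin n)) (τ : Equiv.Perm (Fin n)), H.IsTree ∧
      (∀ i, deg H (τ i) = d' i) ∧ specRad G < specRad H := by
  induction hm : ∑ j, (∑ i ∈ Finset.Iic j, d' i - ∑ i ∈ Finset.Iic j, d i)
    using Nat.strong_induction_on generalizing d G σ with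
  | _ m ih =>
  obtain ⟨i, j, hij, hj, hanti, hmaj'⟩ :=
    exists_transferUnit_majorized hd hd' hpos hsum hmaj hne
  have hsumk := sum_Iic_transferUnit d hij (by omega)
  have hsum' : ∑ l, transferUnit d i j l = ∑ l, d' l := by
    have hlast : Finset.Iic (⟨n - 1, by have := i.2; omega⟩ : Fin n) = Finset.univ := by
      ext x
      simp only [Finset.mem_Iic, Fin.le_def, Finset.mem_univ, iff_true]
      omega
    have h := hsumk ⟨n - 1, by have := i.2; omega⟩
    rw [hlast, if_pos (by rw [← Finset.mem_Iic, hlast]; simp),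
      if_pos (by rw [← Finset.mem_Iic, hlast]; simp)] at h
    omega
  obtain ⟨H, hH, hlt, hrest, hcases⟩ := exists_tree_transfer_degree hG
    (u := σ i) (v := σ j) (by simpa using hij.ne) (by rw [hσ, hσ]; exact hd hij.le)
    (by rw [hσ]; exact hj)
  obtain ⟨τ, hτ⟩ : ∃ τ : Equiv.Perm (Fin n), ∀ l, deg H (τ l) = transferUnit d i j l := by
    have hother : ∀ l, l ≠ i → l ≠ j → deg H (σ l) = d l := fun l hli hlj => by
      rw [hrest _ (by simpa using hli) (by simpa using hlj), hσ]
    rw [hσ, hσ] at hcases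
    rcases hcases with ⟨h1, h2⟩ | ⟨h1, h2⟩
    · refine ⟨σ, fun l => ?_⟩
      unfold transferUnit
      split_ifs with hli hlj
      · rw [hli, h1]
      · rw [hlj, h2]
      · exact hother l hli hlj
    · refine ⟨(Equiv.swap i j).trans σ, fun l => ?_⟩
      unfold transferUnit
      split_ifs with hli hlj
      · simp [hli, h1]
      · simp [hlj, h2]
      · rw [Equiv.trans_apply, Equiv.swap_apply_of_ne_of_ne hli hlj]
        exact hother l hli hlj
  by_cases heq : transferUnit d i j = d'
  · exact ⟨H, τ, hH, fun l => by rw [hτ, heq], hlt⟩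
  · obtain ⟨K, ρ, hK, hρ, hlt'⟩ := ih _ (by
      rw [← hm]
      refine Finset.sum_lt_sum (fun k _ => ?_) ⟨i, Finset.mem_univ i, ?_⟩
      · have h := hsumk k
        have : (if j ≤ k then 1 else 0) ≤ (if i ≤ k then 1 else 0) := by
          split_ifs with h1 h2
          · exact le_rfl
          · exact absurd (hij.le.trans h1) h2
          all_goals simp
        omega
      · have h := hsumk i
        rw [if_neg (not_le.mpr hij), if_pos le_rfl] at h
        have := hmaj' i
        omega) hanti hsum' hmaj' heq hH τ hτ rfl
    exact ⟨K, ρ, hK, hρ, hlt.trans hlt'⟩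

theorem hasDegSeq_iff_exists_perm {n : ℕ} (G : SimpleGraph (Fin n)) (d : Fin n → ℕ) :
    hasDegSeq G d ↔ ∃ σ : Equiv.Perm (Fin n), ∀ i, deg G (σ i) = d i := by
  classical
  constructor
  · intro h
    have hcard : ∀ c, Fintype.card {i // d i = c} = Fintype.card {v // deg G v = c} := by
      intro c
      have hc := congrArg (Multiset.count c) h
      simp only [degMultiset, Multiset.count_map] at hc
      rw [Fintype.card_subtype, Fintype.card_subtype]
      simpa only [Finset.card_def, Finset.filter_val, eq_comm] using hc
    exact ⟨Equiv.ofFiberEquiv fun c => Fintype.equivOfCardEq (hcard c),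
      fun i => Equiv.ofFiberEquiv_map _ i⟩
  · rintro ⟨σ, hσ⟩
    have h : degMultiset G = Finset.univ.val.map (deg G ∘ σ) := by
      rw [degMultiset, ← Multiset.map_map, Multiset.map_univ_val_equiv]
    rw [hasDegSeq, h]
    exact Multiset.map_congr rfl fun i _ => (hσ i).symm

/-- If `d ◁ d'` are distinct tree degree sequences and `G`, `G'` are
trees of greatest spectral radius with degree sequence `d`, `d'` respectively,
then `λ(G) < λ(G')`. -/
theorem spectral_radius_strict_mono_majorization {n : ℕ}
    (d d' : Fin n → ℕ) (hd : IsTreeDegSeq d) (hd' : IsTreeDegSeq d') (hne : d ≠ d')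
    (hmaj : ∀ j : Fin n, ∑ i ∈ Finset.Iic j, d i ≤ ∑ i ∈ Finset.Iic j, d' i)
    (G G' : SimpleGraph (Fin n)) (hG : G.IsTree) (hG' : G'.IsTree)
    (hGd : hasDegSeq G d) (hG'd : hasDegSeq G' d')
    (hGmax : ∀ H : SimpleGraph (Fin n), H.IsTree → hasDegSeq H d →
      specRad H ≤ specRad G)
    (hG'max : ∀ H : SimpleGraph (Fin n), H.IsTree → hasDegSeq H d' →
      specRad H ≤ specRad G') :
    specRad G < specRad G' := by
  obtain ⟨σ, hσ⟩ := (hasDegSeq_iff_exists_perm G d).mp hGd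
  obtain ⟨H, τ, hH, hτ, hlt⟩ := exists_tree_specRad_lt hd.1 hd'.1 hd'.2.1
    (hd.2.2.trans hd'.2.2.symm) hmaj hne hG σ hσ
  exact hlt.trans_le (hG'max H hH ((hasDegSeq_iff_exists_perm H d').mpr ⟨τ, hτ⟩))
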